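/- Let λ be a probability measure on ℕ with probability generating function f(s) = Σ_{j≥0} λ(j) s^j, and suppose q ∈ (0,1) satisfies f(q) = q. Then for every s ∈ [0,1], (f(q + (1−q)s) − q)/(1−q) ≤ f(qs)/q. -/

import Mathlib

open MeasureTheory Filter

/-- A nonnegative sequence weighted by powers of `x ∈ [0,1]` stays summable. -/
lemma summable_mul_pow_of_mem_Icc {p : ℕ → ℝ} (hp : ∀ j, 0 ≤ p j) (h : Summable p)
    {x : ℝ} (hx : x ∈ Set.Icc (0 : ℝ) 1) : Summable fun j => p j * x ^ j :=
  h.of_nonneg_of_le (fun j => mul_nonneg (hp j) (pow_nonneg hx.1 j))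
    fun j => mul_le_of_le_one_right (hp j) (pow_le_one₀ hx.1 hx.2)

/-- The monomial case of the comparison, by convexity of `x ↦ x ^ j`. -/
lemma mul_pow_sub_mul_pow_le {q s : ℝ} (hq : q ∈ Set.Icc (0 : ℝ) 1)
    (hs : s ∈ Set.Icc (0 : ℝ) 1) (j : ℕ) :
    (1 - q) * (q ^ j - (q * s) ^ j) ≤ q * (1 - (q + (1 - q) * s) ^ j) := by
  obtain ⟨hq0, hq1⟩ := hq
  obtain ⟨hs0, hs1⟩ := hs
  rcases Nat.eq_zero_or_pos j with rfl | hj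
  · simp
  have hconv : (q + (1 - q) * s) ^ j ≤ q + (1 - q) * s ^ j := by
    simpa using (convexOn_pow j).2 (Set.mem_Ici.2 (zero_le_one' ℝ)) (Set.mem_Ici.2 hs0)
      hq0 (sub_nonneg.2 hq1) (add_sub_cancel q 1)
  have hqj : q ^ j ≤ q := pow_le_of_le_one hq0 hq1 hj.ne'
  have hsj : 0 ≤ (1 - q) * (1 - s ^ j) :=
    mul_nonneg (sub_nonneg.2 hq1) (sub_nonneg.2 (pow_le_one₀ hs0 hs1))
  calc (1 - q) * (q ^ j - (q * s) ^ j) = q ^ j * ((1 - q) * (1 - s ^ j)) := by ring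
    _ ≤ q * ((1 - q) * (1 - s ^ j)) := mul_le_mul_of_nonneg_right hqj hsj
    _ ≤ q * (1 - (q + (1 - q) * s) ^ j) := mul_le_mul_of_nonneg_left (by linarith) hq0

/-- If `f` is the p.g.f. of a probability measure on `ℕ` and `q ∈ (0,1)` is a fixed
point of `f`, then `(f(q+(1−q)s)−q)/(1−q) ≤ f(qs)/q` for all `s ∈ [0,1]`. -/
theorem pgf_comparison (p : ℕ → ℝ) (hp : ∀ j, 0 ≤ p j) (hsum : ∑' j, p j = 1)
    (f : ℝ → ℝ) (hf : ∀ s, f s = ∑' j, p j * s ^ j)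
    (q : ℝ) (hq : q ∈ Set.Ioo (0 : ℝ) 1) (hfix : f q = q)
    (s : ℝ) (hs : s ∈ Set.Icc (0 : ℝ) 1) :
    (f (q + (1 - q) * s) - q) / (1 - q) ≤ f (q * s) / q := by
  have hp' : Summable p := by
    by_contra h
    simp [tsum_eq_zero_of_not_summable h] at hsum
  have hasSum {x : ℝ} (hx : x ∈ Set.Icc (0 : ℝ) 1) : HasSum (fun j => p j * x ^ j) (f x) :=
    hf x ▸ (summable_mul_pow_of_mem_Icc hp hp' hx).hasSum
  have hqI : q ∈ Set.Icc (0 : ℝ) 1 := Set.Ioo_subset_Icc_self hq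
  obtain ⟨hq0, hq1⟩ := hq
  obtain ⟨hs0, hs1⟩ := hs
  have hu : q + (1 - q) * s ∈ Set.Icc (0 : ℝ) 1 := ⟨by nlinarith, by nlinarith⟩
  have hqs : q * s ∈ Set.Icc (0 : ℝ) 1 := ⟨by positivity, by nlinarith⟩
  have key : (1 - q) * (f q - f (q * s)) ≤ q * (1 - f (q + (1 - q) * s)) := by
    refine hasSum_le (fun j => ?_) (((hasSum hqI).sub (hasSum hqs)).mul_left (1 - q))
      (((hsum ▸ hp'.hasSum : HasSum p 1).sub (hasSum hu)).mul_left q)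
    linarith [mul_le_mul_of_nonneg_left (mul_pow_sub_mul_pow_le hqI ⟨hs0, hs1⟩ j) (hp j)]
  rw [div_le_div_iff₀ (sub_pos.2 hq1) hq0]
  rw [hfix] at key
  linarith
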